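/- arXiv:2105.10106 — 5 statements merged into one kernel-verified Lean document; each statement's English description precedes it below -/
import Mathlib

section
/- The explicit left eigenvector matrix L is a left inverse of the right eigenvector matrix R: L·R = I₄ (the 4×4 identity matrix). -/
/-- The explicit left eigenvector matrix L of the 2D Euler Jacobian is a left
inverse of the right eigenvector matrix R: L·R = I₄. -/
theorem euler_left_eigenmatrix_mul_right_eigenmatrix
    (γ ρ u v p a K e H : ℝ) (hγ : 1 < γ) (hρ : 0 < ρ) (hp : 0 < p)
    (ha : a = Real.sqrt (γ * p / ρ)) (hK : K = u ^ 2 + v ^ 2)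
    (he : e = p / ((γ - 1) * ρ) + K / 2) (hH : H = e + p / ρ)
    (R L : Matrix (Fin 4) (Fin 4) ℝ)
    (hR : R = !![1, 1, 0, 1;
                 u - a, u, 0, u + a;
                 v, v, 1, v;
                 H - a * u, K / 2, v, H + a * u])
    (hL : L = ((γ - 1) / (2 * a ^ 2)) •
        !![a * u / (γ - 1) + K / 2, -(a / (γ - 1)) - u, -v, 1;
           2 * a ^ 2 / (γ - 1) - K, 2 * u, 2 * v, -2;
           -(2 * a ^ 2 * v / (γ - 1)), 0, 2 * a ^ 2 / (γ - 1), 0;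
           -(a * u / (γ - 1)) + K / 2, a / (γ - 1) - u, -v, 1]) :
    L * R = 1 := by
  have hγ' : γ - 1 ≠ 0 := (sub_pos.mpr hγ).ne'
  have ha_pos : 0 < a := ha ▸ Real.sqrt_pos.mpr (by positivity)
  have ha_sq : a ^ 2 = γ * p / ρ := by
    rw [ha, Real.sq_sqrt (by positivity)]
  have hH' : H = a ^ 2 / (γ - 1) + K / 2 := by
    rw [hH, he, ha_sq]
    field_simp
    ring
  have ha_ne : a ≠ 0 := ha_pos.ne'
  clear ha ha_sq hH he
  subst hR hL hH' hK
  ext i j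
  fin_cases i <;> fin_cases j <;>
    simp [Matrix.mul_apply, Fin.sum_univ_four] <;> field_simp <;> ring
end

section
/- The explicit left eigenvector matrix L is a right inverse of the right eigenvector matrix R: R·L = I₄ (the 4×4 identity matrix); in particular R is invertible with R⁻¹ = L. -/
/-- The explicit left eigenvector matrix L of the 2D Euler Jacobian is a right
inverse of the right eigenvector matrix R: R·L = I₄; in particular R is
invertible with R⁻¹ = L. -/
theorem euler_right_eigenmatrix_mul_left_eigenmatrix
    (γ ρ u v p a K e H : ℝ) (hγ : 1 < γ) (hρ : 0 < ρ) (hp : 0 < p)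
    (ha : a = Real.sqrt (γ * p / ρ)) (hK : K = u ^ 2 + v ^ 2)
    (he : e = p / ((γ - 1) * ρ) + K / 2) (hH : H = e + p / ρ)
    (R L : Matrix (Fin 4) (Fin 4) ℝ)
    (hR : R = !![1, 1, 0, 1;
                 u - a, u, 0, u + a;
                 v, v, 1, v;
                 H - a * u, K / 2, v, H + a * u])
    (hL : L = ((γ - 1) / (2 * a ^ 2)) •
        !![a * u / (γ - 1) + K / 2, -(a / (γ - 1)) - u, -v, 1;
           2 * a ^ 2 / (γ - 1) - K, 2 * u, 2 * v, -2;
           -(2 * a ^ 2 * v / (γ - 1)), 0, 2 * a ^ 2 / (γ - 1), 0;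
           -(a * u / (γ - 1)) + K / 2, a / (γ - 1) - u, -v, 1]) :
    R * L = 1 ∧ IsUnit R ∧ R⁻¹ = L := by
  have hg : γ - 1 ≠ 0 := by linarith
  have hγ0 : 0 < γ := by linarith
  have hpos : 0 < γ * p / ρ := by positivity
  have ha0 : a ≠ 0 := ha ▸ (Real.sqrt_pos.mpr hpos).ne'
  have ha2 : a ^ 2 = γ * p / ρ := by rw [ha, Real.sq_sqrt hpos.le]
  have hHa : H = a ^ 2 / (γ - 1) + K / 2 := by
    rw [hH, he, ha2]
    field_simp
    ring
  have hRL : R * L = 1 := by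
    subst hR hL hHa hK
    rw [Matrix.mul_smul]
    ext i j
    fin_cases i <;> fin_cases j <;>
      simp [-mul_eq_zero] <;> field_simp <;> ring
  exact ⟨hRL, IsUnit.of_mul_eq_one L hRL, Matrix.inv_eq_right_inv hRL⟩
end

section
/- The Euler Jacobian matrix admits the eigendecomposition A = R·Λ·L, where Λ = diag(u−a, u, u, u+a). -/
/-- Eigendecomposition of the 2D Euler Jacobian matrix: A = R·Λ·L with
Λ = diag(u−a, u, u, u+a). -/
theorem euler_jacobian_eigendecomposition
    (γ ρ u v p a K e H : ℝ) (hγ : 1 < γ) (hρ : 0 < ρ) (hp : 0 < p)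
    (ha : a = Real.sqrt (γ * p / ρ)) (hK : K = u ^ 2 + v ^ 2)
    (he : e = p / ((γ - 1) * ρ) + K / 2) (hH : H = e + p / ρ)
    (A R Λ L : Matrix (Fin 4) (Fin 4) ℝ)
    (hA : A = !![0, 1, 0, 0;
                 ((γ - 1) / 2) * K - u ^ 2, (3 - γ) * u, (1 - γ) * v, γ - 1;
                 -(u * v), v, u, 0;
                 (((γ - 1) / 2) * K - H) * u, H - (γ - 1) * u ^ 2,
                   (1 - γ) * (u * v), γ * u])
    (hR : R = !![1, 1, 0, 1;
                 u - a, u, 0, u + a;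
                 v, v, 1, v;
                 H - a * u, K / 2, v, H + a * u])
    (hΛ : Λ = Matrix.diagonal ![u - a, u, u, u + a])
    (hL : L = ((γ - 1) / (2 * a ^ 2)) •
        !![a * u / (γ - 1) + K / 2, -(a / (γ - 1)) - u, -v, 1;
           2 * a ^ 2 / (γ - 1) - K, 2 * u, 2 * v, -2;
           -(2 * a ^ 2 * v / (γ - 1)), 0, 2 * a ^ 2 / (γ - 1), 0;
           -(a * u / (γ - 1)) + K / 2, a / (γ - 1) - u, -v, 1]) :
    A = R * Λ * L := by
  have hg : γ - 1 ≠ 0 := (sub_pos.mpr hγ).ne'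
  have hpos : 0 < γ * p / ρ := by positivity
  have ha0 : a ≠ 0 := ha ▸ (Real.sqrt_pos.mpr hpos).ne'
  have ha2 : a ^ 2 = γ * p / ρ := by rw [ha, Real.sq_sqrt hpos.le]
  have hHa : H = a ^ 2 / (γ - 1) + K / 2 := by
    rw [hH, he, ha2]
    field_simp
    ring
  clear ha ha2 hH he hpos
  subst hA hR hΛ hL hHa hK
  ext i j
  fin_cases i <;> fin_cases j <;>
    simp [Matrix.mul_apply, Fin.sum_univ_four, Matrix.vecMul_diagonal] <;>
    field_simp <;> ring
end

section
/- Rotational invariance of the Euler Jacobian: for every θ ∈ ℝ and every w ∈ D with p(w) > 0, the map w ↦ cos θ·F₁(w) + sin θ·F₂(w) is differentiable at w and the matrix of its Fréchet derivative at w equals T(−θ)·A(T(θ)·w)·T(θ), where A(T(θ)·w) is the explicit Jacobian matrix A evaluated at the primitive variables of T(θ)·w. -/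
/-- Pressure as a function of the conservative variables w = (ρ, ρu, ρv, ρe). -/
noncomputable def eulerPres (γ : ℝ) (w : Fin 4 → ℝ) : ℝ :=
  (γ - 1) * (w 3 - (w 1 ^ 2 + w 2 ^ 2) / (2 * w 0))

/-- The x₁-direction Euler flux in conservative variables. -/
noncomputable def eulerF1 (γ : ℝ) (w : Fin 4 → ℝ) : Fin 4 → ℝ :=
  ![w 1, w 1 ^ 2 / w 0 + eulerPres γ w, w 1 * w 2 / w 0,
    (w 3 + eulerPres γ w) * w 1 / w 0]

/-- The x₂-direction Euler flux in conservative variables. -/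
noncomputable def eulerF2 (γ : ℝ) (w : Fin 4 → ℝ) : Fin 4 → ℝ :=
  ![w 2, w 1 * w 2 / w 0, w 2 ^ 2 / w 0 + eulerPres γ w,
    (w 3 + eulerPres γ w) * w 2 / w 0]

/-- The rotation matrix T(θ) acting on the conservative variables. -/
noncomputable def eulerRot (θ : ℝ) : Matrix (Fin 4) (Fin 4) ℝ :=
  !![1, 0, 0, 0;
     0, Real.cos θ, Real.sin θ, 0;
     0, -Real.sin θ, Real.cos θ, 0;
     0, 0, 0, 1]

/-- The 2D Euler Jacobian matrix A = ∂F₁/∂U in terms of the primitive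
variables ρ, u, v, p. -/
noncomputable def eulerMatA (γ ρ u v p : ℝ) : Matrix (Fin 4) (Fin 4) ℝ :=
  let K := u ^ 2 + v ^ 2
  let e := p / ((γ - 1) * ρ) + K / 2
  let H := e + p / ρ
  !![0, 1, 0, 0;
     ((γ - 1) / 2) * K - u ^ 2, (3 - γ) * u, (1 - γ) * v, γ - 1;
     -(u * v), v, u, 0;
     (((γ - 1) / 2) * K - H) * u, H - (γ - 1) * u ^ 2, (1 - γ) * (u * v), γ * u]

/-- A(w): the Euler Jacobian matrix evaluated at the primitive variables of the
conservative state w. -/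
noncomputable def eulerMatAw (γ : ℝ) (w : Fin 4 → ℝ) : Matrix (Fin 4) (Fin 4) ℝ :=
  eulerMatA γ (w 0) (w 1 / w 0) (w 2 / w 0) (eulerPres γ w)

/-- The pressure is invariant under rotation of the momentum. -/
theorem eulerPres_rot (γ θ : ℝ) (z : Fin 4 → ℝ) :
    eulerPres γ ((eulerRot θ).mulVec z) = eulerPres γ z := by
  have h : (Real.cos θ * z 1 + Real.sin θ * z 2) ^ 2
      + (-(Real.sin θ * z 1) + Real.cos θ * z 2) ^ 2 = z 1 ^ 2 + z 2 ^ 2 := by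
    linear_combination (z 1 ^ 2 + z 2 ^ 2) * Real.sin_sq_add_cos_sq θ
  simp [eulerPres, eulerRot, Matrix.mulVec, dotProduct, Fin.sum_univ_four, h]

/-- Rotational invariance of the Euler flux. -/
theorem eulerFlux_eq_rot (γ θ : ℝ) (z : Fin 4 → ℝ) :
    Real.cos θ • eulerF1 γ z + Real.sin θ • eulerF2 γ z
      = (eulerRot (-θ)).mulVec (eulerF1 γ ((eulerRot θ).mulVec z)) := by
  have h := Real.sin_sq_add_cos_sq θ
  unfold eulerF1 eulerF2
  rw [eulerPres_rot]
  generalize eulerPres γ z = p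
  ext i
  fin_cases i <;> simp [eulerRot, Matrix.mulVec, dotProduct, Fin.sum_univ_four]
  · linear_combination (-(Real.cos θ * z 1 ^ 2 / z 0 + Real.sin θ * z 1 * z 2 / z 0)) * h
  · linear_combination (-(Real.sin θ * z 2 ^ 2 / z 0 + Real.cos θ * z 1 * z 2 / z 0)) * h
  · ring

/-- The matrix `eulerMatAw γ w` is the Jacobian of the first Euler flux. -/
theorem hasFDerivAt_eulerF1 {γ : ℝ} (hγ : γ ≠ 1) {w : Fin 4 → ℝ} (hw : w 0 ≠ 0) :
    HasFDerivAt (eulerF1 γ)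
      (LinearMap.toContinuousLinearMap (Matrix.mulVecLin (eulerMatAw γ w))) w := by
  have hγ' : γ - 1 ≠ 0 := sub_ne_zero.mpr hγ
  have hx (i : Fin 4) : HasFDerivAt (fun z : Fin 4 → ℝ => z i)
      (ContinuousLinearMap.proj (R := ℝ) (φ := fun _ : Fin 4 => ℝ) i) w :=
    hasFDerivAt_apply i w
  have hinv := (hasDerivAt_inv hw).comp_hasFDerivAt w (hx 0)
  have hpres : HasFDerivAt (eulerPres γ) _ w :=
    (((hx 3).sub ((((hx 1).pow 2).add ((hx 2).pow 2)).mul (hinv.const_mul 2⁻¹))).const_mul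
      (γ - 1)).congr_of_eventuallyEq (.of_forall fun z => by
        simp [eulerPres, div_eq_mul_inv, mul_comm])
  rw [hasFDerivAt_pi']
  intro i
  fin_cases i
  · refine (hx 1).congr_fderiv ?_
    ext v
    simp [eulerMatAw, eulerMatA, dotProduct, Fin.sum_univ_four]
  · refine ((((hx 1).pow 2).mul hinv).add hpres).congr_fderiv ?_
    ext v
    simp [eulerMatAw, eulerMatA, dotProduct, Fin.sum_univ_four]
    field_simp
    ring
  · refine (((hx 1).mul (hx 2)).mul hinv).congr_fderiv ?_
    ext v
    simp [eulerMatAw, eulerMatA, dotProduct, Fin.sum_univ_four]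
    field_simp
    ring
  · refine ((((hx 3).add hpres).mul (hx 1)).mul hinv).congr_fderiv ?_
    ext v
    simp [eulerMatAw, eulerMatA, eulerPres, dotProduct, Fin.sum_univ_four]
    field_simp
    ring

/-- Rotational invariance of the Euler Jacobian: the directional flux
cos θ·F₁ + sin θ·F₂ is differentiable at every physical state w, with Jacobian
matrix T(−θ)·A(T(θ)·w)·T(θ). -/
theorem euler_rotated_flux_jacobian
    (γ : ℝ) (hγ : 1 < γ) (θ : ℝ) (w : Fin 4 → ℝ) (hw : 0 < w 0)
    (hp : 0 < eulerPres γ w) :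
    HasFDerivAt (fun z => Real.cos θ • eulerF1 γ z + Real.sin θ • eulerF2 γ z)
      (LinearMap.toContinuousLinearMap
        (Matrix.mulVecLin
          (eulerRot (-θ) * eulerMatAw γ ((eulerRot θ).mulVec w) * eulerRot θ))) w := by
  have h0 : (eulerRot θ).mulVec w 0 = w 0 := by
    simp [eulerRot, Matrix.mulVec, dotProduct, Fin.sum_univ_four]
  have hF := hasFDerivAt_eulerF1 hγ.ne' (w := (eulerRot θ).mulVec w) (h0 ▸ hw.ne')
  have hin := (LinearMap.toContinuousLinearMap
    (Matrix.mulVecLin (eulerRot θ))).hasFDerivAt (x := w)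
  have hout := (LinearMap.toContinuousLinearMap
    (Matrix.mulVecLin (eulerRot (-θ)))).hasFDerivAt
      (x := eulerF1 γ ((eulerRot θ).mulVec w))
  simp only [eulerFlux_eq_rot]
  refine (hout.comp w (hF.comp w hin)).congr_fderiv ?_
  ext1 v
  simp [Matrix.mulVec_mulVec, Matrix.mul_assoc]
end

section
/- The translating isentropic vortex is an exact solution of the 2D Euler equations: at every point (x, y, t) where Θ(x, y, t) > 0, the conservative variable field W = (ρ, ρu, ρv, ρe) built from the vortex profile satisfies ∂ₜW + ∂ₓF₁(W) + ∂_yF₂(W) = 0, where F₁ and F₂ are the Euler flux maps expressed in conservative variables. -/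
/-- Horizontal velocity of the translating isentropic vortex. -/
noncomputable def vtxU (ψ x y t : ℝ) : ℝ :=
  1 + (ψ / (2 * Real.pi)) * Real.exp (0.5 * (1 - ((x - t) ^ 2 + (y - t) ^ 2))) * (-(y - t))

/-- Vertical velocity of the translating isentropic vortex. -/
noncomputable def vtxV (ψ x y t : ℝ) : ℝ :=
  1 + (ψ / (2 * Real.pi)) * Real.exp (0.5 * (1 - ((x - t) ^ 2 + (y - t) ^ 2))) * (x - t)

/-- Temperature of the translating isentropic vortex. -/
noncomputable def vtxΘ (γ ψ x y t : ℝ) : ℝ :=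
  1 - ((γ - 1) * ψ ^ 2 / (8 * γ * Real.pi ^ 2)) *
    Real.exp (1 - ((x - t) ^ 2 + (y - t) ^ 2))

/-- Density of the translating isentropic vortex (entropy p/ρ^γ ≡ 1). -/
noncomputable def vtxρ (γ ψ x y t : ℝ) : ℝ :=
  vtxΘ γ ψ x y t ^ ((1 : ℝ) / (γ - 1))

/-- Pressure of the translating isentropic vortex. -/
noncomputable def vtxP (γ ψ x y t : ℝ) : ℝ :=
  vtxΘ γ ψ x y t ^ (γ / (γ - 1))

/-- Specific total energy of the translating isentropic vortex. -/
noncomputable def vtxE (γ ψ x y t : ℝ) : ℝ :=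
  vtxP γ ψ x y t / ((γ - 1) * vtxρ γ ψ x y t) +
    (vtxU ψ x y t ^ 2 + vtxV ψ x y t ^ 2) / 2

/-- The conservative variable field W = (ρ, ρu, ρv, ρe) of the vortex. -/
noncomputable def vtxW (γ ψ x y t : ℝ) : Fin 4 → ℝ :=
  ![vtxρ γ ψ x y t,
    vtxρ γ ψ x y t * vtxU ψ x y t,
    vtxρ γ ψ x y t * vtxV ψ x y t,
    vtxρ γ ψ x y t * vtxE γ ψ x y t]

/-- The velocity amplitude `(ψ / 2π) exp ((1 - r²) / 2)` of the vortex. -/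
noncomputable def vtxAmp (ψ x y t : ℝ) : ℝ :=
  (ψ / (2 * Real.pi)) * Real.exp (0.5 * (1 - ((x - t) ^ 2 + (y - t) ^ 2)))

lemma vtxU_eq (ψ x y t : ℝ) : vtxU ψ x y t = 1 + vtxAmp ψ x y t * (-(y - t)) := rfl

lemma vtxV_eq (ψ x y t : ℝ) : vtxV ψ x y t = 1 + vtxAmp ψ x y t * (x - t) := rfl

lemma vtxΘ_eq (γ ψ x y t : ℝ) :
    vtxΘ γ ψ x y t = 1 - (γ - 1) / (2 * γ) * vtxAmp ψ x y t ^ 2 := by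
  have h : Real.exp (1 - ((x - t) ^ 2 + (y - t) ^ 2)) =
      Real.exp (0.5 * (1 - ((x - t) ^ 2 + (y - t) ^ 2))) ^ 2 := by
    rw [← Real.exp_nat_mul]
    congr 1
    push_cast
    ring
  rw [vtxΘ, vtxAmp, h]
  ring

lemma vtxρ_pos {γ ψ x y t : ℝ} (hΘ : 0 < vtxΘ γ ψ x y t) : 0 < vtxρ γ ψ x y t :=
  Real.rpow_pos_of_pos hΘ _

lemma eulerPres_vtxW {γ ψ x y t : ℝ} (hγ : 1 < γ) (hΘ : 0 < vtxΘ γ ψ x y t) :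
    eulerPres γ (vtxW γ ψ x y t) = vtxP γ ψ x y t := by
  have hρ := (vtxρ_pos hΘ).ne'
  have hγ' : γ - 1 ≠ 0 := (sub_pos.2 hγ).ne'
  simp only [eulerPres, vtxW, vtxE, Matrix.cons_val]
  field_simp
  ring

lemma vtxρ_mul_vtxE {γ ψ x y t : ℝ} (hγ : 1 < γ) (hΘ : 0 < vtxΘ γ ψ x y t) :
    vtxρ γ ψ x y t * vtxE γ ψ x y t = vtxP γ ψ x y t / (γ - 1) +
      vtxρ γ ψ x y t * (vtxU ψ x y t ^ 2 + vtxV ψ x y t ^ 2) / 2 := by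
  have hρ := (vtxρ_pos hΘ).ne'
  have hγ' : γ - 1 ≠ 0 := (sub_pos.2 hγ).ne'
  rw [vtxE]
  field_simp

lemma vtxW_eq {γ ψ x y t : ℝ} (hγ : 1 < γ) (hΘ : 0 < vtxΘ γ ψ x y t) :
    vtxW γ ψ x y t = ![vtxρ γ ψ x y t, vtxρ γ ψ x y t * vtxU ψ x y t,
      vtxρ γ ψ x y t * vtxV ψ x y t, vtxP γ ψ x y t / (γ - 1) +
        vtxρ γ ψ x y t * (vtxU ψ x y t ^ 2 + vtxV ψ x y t ^ 2) / 2] := by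
  rw [← vtxρ_mul_vtxE hγ hΘ, vtxW]

lemma eulerF1_vtxW {γ ψ x y t : ℝ} (hγ : 1 < γ) (hΘ : 0 < vtxΘ γ ψ x y t) :
    eulerF1 γ (vtxW γ ψ x y t) = ![vtxρ γ ψ x y t * vtxU ψ x y t,
      vtxρ γ ψ x y t * vtxU ψ x y t ^ 2 + vtxP γ ψ x y t,
      vtxρ γ ψ x y t * vtxU ψ x y t * vtxV ψ x y t,
      (vtxP γ ψ x y t / (γ - 1) + vtxρ γ ψ x y t * (vtxU ψ x y t ^ 2 + vtxV ψ x y t ^ 2) / 2 +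
        vtxP γ ψ x y t) * vtxU ψ x y t] := by
  have hρ := (vtxρ_pos hΘ).ne'
  rw [eulerF1, eulerPres_vtxW hγ hΘ, vtxW_eq hγ hΘ]
  ext i
  fin_cases i <;> simp <;> field_simp

lemma eulerF2_vtxW {γ ψ x y t : ℝ} (hγ : 1 < γ) (hΘ : 0 < vtxΘ γ ψ x y t) :
    eulerF2 γ (vtxW γ ψ x y t) = ![vtxρ γ ψ x y t * vtxV ψ x y t,
      vtxρ γ ψ x y t * vtxU ψ x y t * vtxV ψ x y t,
      vtxρ γ ψ x y t * vtxV ψ x y t ^ 2 + vtxP γ ψ x y t,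
      (vtxP γ ψ x y t / (γ - 1) + vtxρ γ ψ x y t * (vtxU ψ x y t ^ 2 + vtxV ψ x y t ^ 2) / 2 +
        vtxP γ ψ x y t) * vtxV ψ x y t] := by
  have hρ := (vtxρ_pos hΘ).ne'
  rw [eulerF2, eulerPres_vtxW hγ hΘ, vtxW_eq hγ hΘ]
  ext i
  fin_cases i <;> simp <;> field_simp

section Curve

variable {γ ψ s x' y' t' : ℝ} {x y t : ℝ → ℝ}

lemma hasDerivAt_vtxAmp (hx : HasDerivAt x x' s) (hy : HasDerivAt y y' s)
    (ht : HasDerivAt t t' s) :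
    HasDerivAt (fun r => vtxAmp ψ (x r) (y r) (t r))
      (-vtxAmp ψ (x s) (y s) (t s) *
        ((x s - t s) * (x' - t') + (y s - t s) * (y' - t'))) s := by
  have h := ((((((hx.fun_sub ht).fun_pow 2).fun_add ((hy.fun_sub ht).fun_pow 2)).const_sub
    1).const_mul 0.5).exp).const_mul (ψ / (2 * Real.pi))
  refine h.congr_deriv ?_
  rw [vtxAmp]
  norm_num
  ring

lemma hasDerivAt_vtxU (hx : HasDerivAt x x' s) (hy : HasDerivAt y y' s)
    (ht : HasDerivAt t t' s) :
    HasDerivAt (fun r => vtxU ψ (x r) (y r) (t r))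
      (vtxAmp ψ (x s) (y s) (t s) *
        (((x s - t s) * (x' - t') + (y s - t s) * (y' - t')) * (y s - t s) - (y' - t'))) s := by
  have h := ((hasDerivAt_vtxAmp (ψ := ψ) hx hy ht).fun_mul (hy.fun_sub ht).fun_neg).const_add 1
  exact h.congr_deriv (by ring)

lemma hasDerivAt_vtxV (hx : HasDerivAt x x' s) (hy : HasDerivAt y y' s)
    (ht : HasDerivAt t t' s) :
    HasDerivAt (fun r => vtxV ψ (x r) (y r) (t r))
      (vtxAmp ψ (x s) (y s) (t s) *
        ((x' - t') - ((x s - t s) * (x' - t') + (y s - t s) * (y' - t')) * (x s - t s))) s := by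
  have h := ((hasDerivAt_vtxAmp (ψ := ψ) hx hy ht).fun_mul (hx.fun_sub ht)).const_add 1
  exact h.congr_deriv (by ring)

lemma hasDerivAt_vtxΘ (hx : HasDerivAt x x' s) (hy : HasDerivAt y y' s)
    (ht : HasDerivAt t t' s) :
    HasDerivAt (fun r => vtxΘ γ ψ (x r) (y r) (t r))
      ((γ - 1) / γ * vtxAmp ψ (x s) (y s) (t s) ^ 2 *
        ((x s - t s) * (x' - t') + (y s - t s) * (y' - t'))) s := by
  have h := (((hasDerivAt_vtxAmp (ψ := ψ) hx hy ht).fun_pow 2).const_mul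
    ((γ - 1) / (2 * γ))).const_sub 1
  simp only [vtxΘ_eq]
  refine h.congr_deriv ?_
  push_cast
  ring

lemma hasDerivAt_vtxρ (hγ : 1 < γ) (hΘ : 0 < vtxΘ γ ψ (x s) (y s) (t s))
    (hx : HasDerivAt x x' s) (hy : HasDerivAt y y' s) (ht : HasDerivAt t t' s) :
    HasDerivAt (fun r => vtxρ γ ψ (x r) (y r) (t r))
      (vtxρ γ ψ (x s) (y s) (t s) / (γ * vtxΘ γ ψ (x s) (y s) (t s)) *
        vtxAmp ψ (x s) (y s) (t s) ^ 2 *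
        ((x s - t s) * (x' - t') + (y s - t s) * (y' - t'))) s := by
  have hγ' : γ - 1 ≠ 0 := (sub_pos.2 hγ).ne'
  have h := (hasDerivAt_vtxΘ (γ := γ) (ψ := ψ) hx hy ht).rpow_const
    (p := 1 / (γ - 1)) (Or.inl hΘ.ne')
  refine h.congr_deriv ?_
  rw [Real.rpow_sub_one hΘ.ne', vtxρ]
  field_simp

lemma hasDerivAt_vtxP (hγ : 1 < γ) (hΘ : 0 < vtxΘ γ ψ (x s) (y s) (t s))
    (hx : HasDerivAt x x' s) (hy : HasDerivAt y y' s) (ht : HasDerivAt t t' s) :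
    HasDerivAt (fun r => vtxP γ ψ (x r) (y r) (t r))
      (vtxρ γ ψ (x s) (y s) (t s) * vtxAmp ψ (x s) (y s) (t s) ^ 2 *
        ((x s - t s) * (x' - t') + (y s - t s) * (y' - t'))) s := by
  have hγ' : γ - 1 ≠ 0 := (sub_pos.2 hγ).ne'
  have h := (hasDerivAt_vtxΘ (γ := γ) (ψ := ψ) hx hy ht).rpow_const
    (p := γ / (γ - 1)) (Or.inl hΘ.ne')
  refine h.congr_deriv ?_
  have e : γ / (γ - 1) - 1 = 1 / (γ - 1) := by
    field_simp
    ring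
  rw [e, vtxρ]
  field_simp

lemma eventually_vtxΘ_pos (hΘ : 0 < vtxΘ γ ψ (x s) (y s) (t s))
    (hx : HasDerivAt x x' s) (hy : HasDerivAt y y' s) (ht : HasDerivAt t t' s) :
    ∀ᶠ r in nhds s, 0 < vtxΘ γ ψ (x r) (y r) (t r) :=
  (hasDerivAt_vtxΘ hx hy ht).continuousAt.eventually (lt_mem_nhds hΘ)

end Curve

/-- The translating isentropic vortex is an exact solution of the 2D Euler
equations: wherever the temperature is positive,
∂ₜW + ∂ₓF₁(W) + ∂_yF₂(W) = 0 componentwise. -/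
theorem isentropic_vortex_solves_euler
    (γ ψ : ℝ) (hγ : 1 < γ) (x y t : ℝ) (hΘ : 0 < vtxΘ γ ψ x y t) :
    ∀ i : Fin 4,
      deriv (fun s => vtxW γ ψ x y s i) t +
        deriv (fun s => eulerF1 γ (vtxW γ ψ s y t) i) x +
        deriv (fun s => eulerF2 γ (vtxW γ ψ x s t) i) y = 0 := by
  have hγ' : γ - 1 ≠ 0 := (sub_pos.2 hγ).ne'
  have cst (a b : ℝ) : HasDerivAt (fun _ : ℝ => a) 0 b := hasDerivAt_const b a
  have hWt := (eventually_vtxΘ_pos (x := fun _ => x) (y := fun _ => y) (t := fun s => s)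
    hΘ (cst x t) (cst y t) (hasDerivAt_id' t)).mono fun _ h => vtxW_eq hγ h
  have hFx := (eventually_vtxΘ_pos (x := fun s => s) (y := fun _ => y) (t := fun _ => t)
    hΘ (hasDerivAt_id' x) (cst y x) (cst t x)).mono fun _ h => eulerF1_vtxW hγ h
  have hFy := (eventually_vtxΘ_pos (x := fun _ => x) (y := fun s => s) (t := fun _ => t)
    hΘ (cst x y) (hasDerivAt_id' y) (cst t y)).mono fun _ h => eulerF2_vtxW hγ h
  have ut := hasDerivAt_vtxU (ψ := ψ) (x := fun _ => x) (y := fun _ => y) (t := fun s => s)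
    (cst x t) (cst y t) (hasDerivAt_id' t)
  have vt := hasDerivAt_vtxV (ψ := ψ) (x := fun _ => x) (y := fun _ => y) (t := fun s => s)
    (cst x t) (cst y t) (hasDerivAt_id' t)
  have ρt := hasDerivAt_vtxρ (ψ := ψ) (x := fun _ => x) (y := fun _ => y) (t := fun s => s)
    hγ hΘ (cst x t) (cst y t) (hasDerivAt_id' t)
  have pt := hasDerivAt_vtxP (ψ := ψ) (x := fun _ => x) (y := fun _ => y) (t := fun s => s)
    hγ hΘ (cst x t) (cst y t) (hasDerivAt_id' t)
  have ux := hasDerivAt_vtxU (ψ := ψ) (x := fun s => s) (y := fun _ => y) (t := fun _ => t)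
    (hasDerivAt_id' x) (cst y x) (cst t x)
  have vx := hasDerivAt_vtxV (ψ := ψ) (x := fun s => s) (y := fun _ => y) (t := fun _ => t)
    (hasDerivAt_id' x) (cst y x) (cst t x)
  have ρx := hasDerivAt_vtxρ (ψ := ψ) (x := fun s => s) (y := fun _ => y) (t := fun _ => t)
    hγ hΘ (hasDerivAt_id' x) (cst y x) (cst t x)
  have px := hasDerivAt_vtxP (ψ := ψ) (x := fun s => s) (y := fun _ => y) (t := fun _ => t)
    hγ hΘ (hasDerivAt_id' x) (cst y x) (cst t x)
  have uy := hasDerivAt_vtxU (ψ := ψ) (x := fun _ => x) (y := fun s => s) (t := fun _ => t)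
    (cst x y) (hasDerivAt_id' y) (cst t y)
  have vy := hasDerivAt_vtxV (ψ := ψ) (x := fun _ => x) (y := fun s => s) (t := fun _ => t)
    (cst x y) (hasDerivAt_id' y) (cst t y)
  have ρy := hasDerivAt_vtxρ (ψ := ψ) (x := fun _ => x) (y := fun s => s) (t := fun _ => t)
    hγ hΘ (cst x y) (hasDerivAt_id' y) (cst t y)
  have py := hasDerivAt_vtxP (ψ := ψ) (x := fun _ => x) (y := fun s => s) (t := fun _ => t)
    hγ hΘ (cst x y) (hasDerivAt_id' y) (cst t y)
  have et := (pt.div_const (γ - 1)).fun_add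
    ((ρt.fun_mul ((ut.fun_pow 2).fun_add (vt.fun_pow 2))).div_const 2)
  have ex := (px.div_const (γ - 1)).fun_add
    ((ρx.fun_mul ((ux.fun_pow 2).fun_add (vx.fun_pow 2))).div_const 2)
  have ey := (py.div_const (γ - 1)).fun_add
    ((ρy.fun_mul ((uy.fun_pow 2).fun_add (vy.fun_pow 2))).div_const 2)
  intro i
  rw [Filter.EventuallyEq.deriv_eq (hWt.mono fun _ h => congrFun h i),
    Filter.EventuallyEq.deriv_eq (hFx.mono fun _ h => congrFun h i),
    Filter.EventuallyEq.deriv_eq (hFy.mono fun _ h => congrFun h i)]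
  fin_cases i
  · refine (congrArg₂ (· + ·) (congrArg₂ (· + ·) ρt.deriv
      (HasDerivAt.deriv (ρx.fun_mul ux)))
      (HasDerivAt.deriv (ρy.fun_mul vy))).trans ?_
    simp only [vtxU_eq, vtxV_eq]
    field_simp
    ring
  · refine (congrArg₂ (· + ·) (congrArg₂ (· + ·) (HasDerivAt.deriv
      (ρt.fun_mul ut))
      (HasDerivAt.deriv ((ρx.fun_mul (ux.fun_pow 2)).fun_add px)))
      (HasDerivAt.deriv ((ρy.fun_mul uy).fun_mul vy))).trans ?_
    simp only [vtxU_eq, vtxV_eq]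
    field_simp
    ring
  · refine (congrArg₂ (· + ·) (congrArg₂ (· + ·) (HasDerivAt.deriv
      (ρt.fun_mul vt))
      (HasDerivAt.deriv ((ρx.fun_mul ux).fun_mul vx)))
      (HasDerivAt.deriv ((ρy.fun_mul (vy.fun_pow 2)).fun_add py))).trans ?_
    simp only [vtxU_eq, vtxV_eq]
    field_simp
    ring
  · refine (congrArg₂ (· + ·) (congrArg₂ (· + ·) et.deriv
      (HasDerivAt.deriv ((ex.fun_add px).fun_mul ux)))
      (HasDerivAt.deriv ((ey.fun_add py).fun_mul vy))).trans ?_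
    simp only [vtxU_eq, vtxV_eq]
    field_simp
    ring
end
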